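/- (Proposition 4.1, first part.) For the PBM model, i.i.d. queries q ~ Pr(Q), and under the condition that the query distribution is independent of the choice of ranker, the expectation of the non-click count ¬ĉ_k^{k,k'} satisfies E[¬ĉ_k^{k,k'}] = N_{k,k'} − p_k · r_{k,k'}, where r_{k,k'} = E_q[ Σ_{d ∈ Ω(q)} 1[(q,d) ∈ S_{k,k'}] · rel(q,d) ] and N_{k,k'} = E_q[ Σ_{d ∈ Ω(q)} 1[(q,d) ∈ S_{k,k'}] ]. Concretely: Σ_{i=1}^m Σ_{j=1}^{n_i} Σ_{q ∈ Q} Pr(q) Σ_{d ∈ Ω(q)} 1[(q,d) ∈ S_{k,k'}] · 1[rank(d | f_i(q)) = k] · (1 − p_k · rel(q,d)) / w(q,d,k) = N_{k,k'} − p_k · r_{k,k'}, provided that for every (q,d) ∈ S_{k,k'} with Pr(q) > 0 some ranker with n_i > 0 places d at rank k. -/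

import Mathlib

/-- Real-valued indicator of a proposition. -/
noncomputable def indR (P : Prop) : ℝ := @ite ℝ P (Classical.propDecidable P) 1 0

/-- Membership of the pair `(q, d)` in the interventional set `S_{k,k'}`:
`d` is a candidate for `q`, some ranker puts `d` at rank `k` for `q`,
and some (other) ranker puts `d` at rank `k'` for `q`. -/
def Smem {Q D : Type*} (m : ℕ) (rnk : Fin m → Q → D → ℕ) (Ω : Q → Finset D)
    (q : Q) (d : D) (k k' : ℕ) : Prop :=
  d ∈ Ω q ∧ (∃ i : Fin m, rnk i q d = k) ∧ (∃ i' : Fin m, rnk i' q d = k')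

/-- The weight `w(q,d,k) = ∑_i n_i · 1[rank(d | f_i(q)) = k]`. -/
noncomputable def wgt {Q D : Type*} (m : ℕ) (n : Fin m → ℕ) (rnk : Fin m → Q → D → ℕ)
    (q : Q) (d : D) (k : ℕ) : ℝ :=
  ∑ i : Fin m, (n i : ℝ) * indR (rnk i q d = k)

theorem indR_of_true {P : Prop} (h : P) : indR P = 1 := if_pos h

theorem indR_of_false {P : Prop} (h : ¬P) : indR P = 0 := if_neg h

theorem indR_nonneg (P : Prop) : 0 ≤ indR P := by
  by_cases h : P
  · simp [indR_of_true h]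
  · simp [indR_of_false h]

theorem wgt_pos {Q D : Type*} {m : ℕ} {n : Fin m → ℕ} {rnk : Fin m → Q → D → ℕ}
    {q : Q} {d : D} {k : ℕ} (h : ∃ i : Fin m, 0 < n i ∧ rnk i q d = k) :
    0 < wgt m n rnk q d k := by
  obtain ⟨i, hi, hik⟩ := h
  refine Finset.sum_pos' (fun j _ => mul_nonneg (Nat.cast_nonneg _) (indR_nonneg _))
    ⟨i, Finset.mem_univ i, ?_⟩
  simpa [indR_of_true hik] using hi

/-- Averaging a rank-independent quantity with the inverse weights returns that quantity. -/
theorem sum_mul_indR_mul_div_wgt {Q D : Type*} {m : ℕ} {n : Fin m → ℕ}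
    {rnk : Fin m → Q → D → ℕ} {q : Q} {d : D} {k : ℕ}
    (h : wgt m n rnk q d k ≠ 0) (c : ℝ) :
    ∑ i : Fin m, (n i : ℝ) * (indR (rnk i q d = k) * c / wgt m n rnk q d k) = c := by
  simp_rw [mul_div_assoc, ← mul_assoc]
  rw [← Finset.sum_mul]
  exact mul_div_cancel₀ c h

/-- **Proposition 4.1, first part.** For the PBM model, i.i.d. queries
`q ~ Pr(Q)`, and under the condition that the query distribution is independent of the
choice of ranker, the expectation of the non-click count `¬ĉ_k^{k,k'}` satisfies
`E[¬ĉ_k^{k,k'}] = N_{k,k'} − p k · r_{k,k'}`, where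
`r_{k,k'} = E_q[∑_{d ∈ Ω(q)} 1[(q,d) ∈ S_{k,k'}] · rel(q,d)]` and
`N_{k,k'} = E_q[∑_{d ∈ Ω(q)} 1[(q,d) ∈ S_{k,k'}]]`, provided that for every
`(q,d) ∈ S_{k,k'}` with `Pr q > 0` some ranker with `n i > 0` places `d` at rank `k`. -/
theorem prop_4_1_first_part {Q D : Type*} [Fintype Q]
    (Pr : Q → ℝ) (Ω : Q → Finset D) (rel : Q → D → ℝ)
    (m : ℕ) (n : Fin m → ℕ) (rnk : Fin m → Q → D → ℕ)
    (p : ℕ → ℝ) (k k' : ℕ)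
    (hkk' : k ≠ k')
    (hrel : ∀ q d, rel q d = 0 ∨ rel q d = 1)
    (hp : ∀ j, 0 ≤ p j ∧ p j ≤ 1)
    (hPr : ∀ q, 0 ≤ Pr q) (hPrsum : ∑ q : Q, Pr q = 1)
    (hsupp : ∀ q d, Smem m rnk Ω q d k k' → 0 < Pr q →
      ∃ i : Fin m, 0 < n i ∧ rnk i q d = k) :
    ∑ i : Fin m, ∑ _j ∈ Finset.range (n i), ∑ q : Q, Pr q *
        ∑ d ∈ Ω q, indR (Smem m rnk Ω q d k k') * indR (rnk i q d = k) *
          (1 - p k * rel q d) / wgt m n rnk q d k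
      = (∑ q : Q, Pr q * ∑ d ∈ Ω q, indR (Smem m rnk Ω q d k k'))
        - p k * ∑ q : Q, Pr q *
            ∑ d ∈ Ω q, indR (Smem m rnk Ω q d k k') * rel q d := by
  calc
    _ = ∑ q : Q, ∑ d ∈ Ω q, Pr q * (indR (Smem m rnk Ω q d k k') *
          ∑ i : Fin m, (n i : ℝ) *
            (indR (rnk i q d = k) * (1 - p k * rel q d) / wgt m n rnk q d k)) := by
      simp_rw [Finset.sum_const, Finset.card_range, nsmul_eq_mul, Finset.mul_sum]
      rw [Finset.sum_comm]
      refine Finset.sum_congr rfl fun q _ => ?_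
      rw [Finset.sum_comm]
      refine Finset.sum_congr rfl fun d _ => Finset.sum_congr rfl fun i _ => ?_
      ring
    _ = ∑ q : Q, ∑ d ∈ Ω q, Pr q *
          (indR (Smem m rnk Ω q d k k') * (1 - p k * rel q d)) := by
      refine Finset.sum_congr rfl fun q _ => Finset.sum_congr rfl fun d _ => ?_
      rcases (hPr q).eq_or_lt with hq | hq
      · simp [← hq]
      · by_cases hS : Smem m rnk Ω q d k k'
        · rw [sum_mul_indR_mul_div_wgt (wgt_pos (hsupp q d hS hq)).ne']
        · simp [indR_of_false hS]
    _ = _ := by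
      simp_rw [Finset.mul_sum, ← Finset.sum_sub_distrib]
      refine Finset.sum_congr rfl fun q _ => Finset.sum_congr rfl fun d _ => ?_
      ring
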